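/- arXiv:2309.12799 — 2 statements merged into one kernel-verified Lean document; each statement's English description precedes it below -/
import Mathlib

section
/- Stochastic domination from a single-edge condition and one lattice density: Let E be a finite set, for each e ∈ E let ρ_e be a finite Borel measure on (0,∞), and ρ = ⊗_{e∈E} ρ_e the product measure on S = (0,∞)^E. Let μ₁ = s₁·ρ and μ₂ = s₂·ρ be probability measures with strictly positive densities s₁, s₂ > 0, and suppose at least one of s₁, s₂ satisfies the lattice condition s(κ ∨ κ′)·s(κ ∧ κ′) ≥ s(κ)·s(κ′) for all κ, κ′ ∈ S. If s₂(κ_f^+)·s₁(κ_f^−) ≥ s₁(κ_f^+)·s₂(κ_f^−) for all κ ∈ S, f ∈ E, and 0 < c_f^− < c_f^+, then μ₁ is stochastically dominated by μ₂: ∫ f dμ₁ ≤ ∫ f dμ₂ for every bounded measurable increasing f : S → ℝ. -/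
open MeasureTheory

/-- The arithmetic core of the one-dimensional four functions inequality. -/
theorem ENNReal.add_le_add_of_le_of_mul_le {a b c d : ENNReal} (ha : a ≤ c) (hb : b ≤ c)
    (hab : a * b ≤ c * d) : a + b ≤ c + d := by
  rcases eq_or_ne c ⊤ with rfl | hc
  · simp
  rcases eq_or_ne d ⊤ with rfl | hd
  · simp
  lift a to NNReal using ne_top_of_le_ne_top hc ha
  lift b to NNReal using ne_top_of_le_ne_top hc hb
  lift c to NNReal using hc
  lift d to NNReal using hd
  norm_cast at *
  rcases eq_or_ne c 0 with rfl | hc0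
  · simp_all
  have hcpos : (0 : ℝ) < c := by exact_mod_cast pos_iff_ne_zero.mpr hc0
  rw [← NNReal.coe_le_coe] at *
  push_cast at *
  refine le_of_mul_le_mul_left ?_ hcpos
  nlinarith [mul_nonneg (sub_nonneg.mpr ha) (sub_nonneg.mpr hb)]

/-- The four functions inequality for a measure on a linear order. -/
theorem lintegral_mul_lintegral_le_of_sup_inf {X : Type*} [LinearOrder X] [MeasurableSpace X]
    (μ : Measure X) [SFinite μ] {f₁ f₂ f₃ f₄ : X → ENNReal}
    (h₁ : Measurable f₁) (h₂ : Measurable f₂) (h₃ : Measurable f₃) (h₄ : Measurable f₄)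
    (h : ∀ x y, f₁ x * f₂ y ≤ f₃ (x ⊔ y) * f₄ (x ⊓ y)) :
    (∫⁻ x, f₁ x ∂μ) * ∫⁻ x, f₂ x ∂μ ≤ (∫⁻ x, f₃ x ∂μ) * ∫⁻ x, f₄ x ∂μ := by
  have symmetrize {g k : X → ENNReal} (hg : Measurable g) (hk : Measurable k) :
      2 * ((∫⁻ x, g x ∂μ) * ∫⁻ x, k x ∂μ)
        = ∫⁻ p : X × X, (g p.1 * k p.2 + k p.1 * g p.2) ∂μ.prod μ := by
    rw [lintegral_add_left (by fun_prop), lintegral_prod_mul hg.aemeasurable hk.aemeasurable,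
      lintegral_prod_mul hk.aemeasurable hg.aemeasurable, two_mul]
    congr 1
    exact mul_comm _ _
  have key (x y : X) (hxy : x ≤ y) :
      f₁ x * f₂ y + f₂ x * f₁ y ≤ f₃ x * f₄ y + f₄ x * f₃ y := by
    rw [add_comm (f₃ x * f₄ y)]
    refine ENNReal.add_le_add_of_le_of_mul_le ?_ ?_ ?_
    · simpa [hxy, mul_comm] using h x y
    · simpa [hxy, mul_comm] using h y x
    · calc f₁ x * f₂ y * (f₂ x * f₁ y) = (f₁ x * f₂ x) * (f₁ y * f₂ y) := by ring
        _ ≤ (f₃ x * f₄ x) * (f₃ y * f₄ y) := by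
          exact mul_le_mul' (by simpa using h x x) (by simpa using h y y)
        _ = f₄ x * f₃ y * (f₃ x * f₄ y) := by ring
  refine (ENNReal.mul_le_mul_iff_right two_ne_zero ENNReal.ofNat_ne_top).mp ?_
  rw [symmetrize h₁ h₂, symmetrize h₃ h₄]
  refine lintegral_mono fun p => ?_
  rcases le_total p.1 p.2 with hp | hp
  · exact key _ _ hp
  · have := key _ _ hp
    calc _ = f₁ p.2 * f₂ p.1 + f₂ p.2 * f₁ p.1 := by ring
      _ ≤ _ := this
      _ = _ := by ring

/-- The lattice four functions condition is preserved by integrating out coordinates. -/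
theorem lmarginal_mul_lmarginal_le_of_sup_inf {E : Type*} [DecidableEq E] {X : E → Type*}
    [∀ e, LinearOrder (X e)] [∀ e, MeasurableSpace (X e)]
    (μ : ∀ e, Measure (X e)) [∀ e, SigmaFinite (μ e)] (s : Finset E)
    {f₁ f₂ f₃ f₄ : (∀ e, X e) → ENNReal}
    (h₁ : Measurable f₁) (h₂ : Measurable f₂) (h₃ : Measurable f₃) (h₄ : Measurable f₄)
    (h : ∀ x y, f₁ x * f₂ y ≤ f₃ (x ⊔ y) * f₄ (x ⊓ y)) (x y : ∀ e, X e) :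
    lmarginal μ s f₁ x * lmarginal μ s f₂ y
      ≤ lmarginal μ s f₃ (x ⊔ y) * lmarginal μ s f₄ (x ⊓ y) := by
  induction s using Finset.induction_on generalizing x y with
  | empty => simpa using h x y
  | insert i s hi ih =>
    rw [lmarginal_insert _ h₁ hi, lmarginal_insert _ h₂ hi, lmarginal_insert _ h₃ hi,
      lmarginal_insert _ h₄ hi]
    refine lintegral_mul_lintegral_le_of_sup_inf (μ i)
      ((h₁.lmarginal μ).comp (measurable_update x)) ((h₂.lmarginal μ).comp (measurable_update y))
      ((h₃.lmarginal μ).comp (measurable_update _)) ((h₄.lmarginal μ).comp (measurable_update _))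
      fun t u => ?_
    have hsup : Function.update (x ⊔ y) i (t ⊔ u)
        = Function.update x i t ⊔ Function.update y i u := by
      ext j
      rcases eq_or_ne j i with rfl | hj <;> simp [*]
    have hinf : Function.update (x ⊓ y) i (t ⊓ u)
        = Function.update x i t ⊓ Function.update y i u := by
      ext j
      rcases eq_or_ne j i with rfl | hj <;> simp [*]
    rw [hsup, hinf]
    exact ih _ _

/-- The four functions inequality for product measures on products of linear orders. -/
theorem lintegral_pi_mul_lintegral_pi_le_of_sup_inf {E : Type*} [Fintype E] {X : E → Type*}
    [∀ e, LinearOrder (X e)] [∀ e, MeasurableSpace (X e)]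
    (μ : ∀ e, Measure (X e)) [∀ e, SigmaFinite (μ e)]
    {f₁ f₂ f₃ f₄ : (∀ e, X e) → ENNReal}
    (h₁ : Measurable f₁) (h₂ : Measurable f₂) (h₃ : Measurable f₃) (h₄ : Measurable f₄)
    (h : ∀ x y, f₁ x * f₂ y ≤ f₃ (x ⊔ y) * f₄ (x ⊓ y)) :
    (∫⁻ x, f₁ x ∂Measure.pi μ) * ∫⁻ x, f₂ x ∂Measure.pi μ
      ≤ (∫⁻ x, f₃ x ∂Measure.pi μ) * ∫⁻ x, f₄ x ∂Measure.pi μ := by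
  classical
  rcases isEmpty_or_nonempty (∀ e, X e) with hX | ⟨⟨x⟩⟩
  · simp
  · have := lmarginal_mul_lmarginal_le_of_sup_inf μ Finset.univ h₁ h₂ h₃ h₄ h x x
    simpa [lmarginal_univ] using this

/-- If the ratio `s₂ / s₁` is monotone in each coordinate separately, it is monotone. -/
theorem mul_le_mul_of_single_edge {E : Type*} [Fintype E] [DecidableEq E]
    {s₁ s₂ : (E → ℝ) → ℝ}
    (hs₁pos : ∀ κ : E → ℝ, (∀ e, 0 < κ e) → 0 < s₁ κ)
    (hs₂pos : ∀ κ : E → ℝ, (∀ e, 0 < κ e) → 0 < s₂ κ)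
    (hsingle : ∀ (κ : E → ℝ), (∀ e, 0 < κ e) → ∀ (f : E) (cfm cfp : ℝ),
        0 < cfm → cfm < cfp →
        s₁ (Function.update κ f cfp) * s₂ (Function.update κ f cfm)
          ≤ s₂ (Function.update κ f cfp) * s₁ (Function.update κ f cfm))
    {x y : E → ℝ} (hx : ∀ e, 0 < x e) (hxy : x ≤ y) :
    s₁ y * s₂ x ≤ s₂ y * s₁ x := by
  have hpos (T : Finset E) (e : E) : 0 < T.piecewise y x e := by
    by_cases he : e ∈ T
    · simpa [he] using (hx e).trans_le (hxy e)
    · simpa [he] using hx e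
  have step (T : Finset E) :
      s₁ (T.piecewise y x) * s₂ x ≤ s₂ (T.piecewise y x) * s₁ x := by
    induction T using Finset.induction_on with
    | empty => simp [mul_comm]
    | insert i T hi ih =>
      have hz := hpos T
      have hz' := hpos (insert i T)
      rw [Finset.piecewise_insert] at hz' ⊢
      set z := T.piecewise y x with hzdef
      have hzi : z i = x i := by simp [hzdef, hi]
      rcases (hxy i).eq_or_lt with hi' | hi'
      · rwa [← hi', ← hzi, Function.update_eq_self]
      · have h := hsingle z hz i (x i) (y i) (hx i) hi'
        rw [← hzi, Function.update_eq_self] at h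
        refine le_of_mul_le_mul_right ?_ (mul_pos (hs₁pos z hz) (hs₂pos z hz))
        have := mul_le_mul h ih (mul_pos (hs₁pos z hz) (hs₂pos x hx)).le
          (mul_pos (hs₂pos _ hz') (hs₁pos z hz)).le
        linarith
  simpa using step Finset.univ

/-- The single-edge condition and the lattice condition for one density give Holley's condition. -/
theorem holley_condition_of_single_edge {E : Type*} [Fintype E] [DecidableEq E]
    {s₁ s₂ : (E → ℝ) → ℝ}
    (hs₁pos : ∀ κ : E → ℝ, (∀ e, 0 < κ e) → 0 < s₁ κ)
    (hs₂pos : ∀ κ : E → ℝ, (∀ e, 0 < κ e) → 0 < s₂ κ)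
    (hlattice :
      (∀ κ κ' : E → ℝ, (∀ e, 0 < κ e) → (∀ e, 0 < κ' e) →
          s₁ κ * s₁ κ' ≤ s₁ (κ ⊔ κ') * s₁ (κ ⊓ κ')) ∨
      (∀ κ κ' : E → ℝ, (∀ e, 0 < κ e) → (∀ e, 0 < κ' e) →
          s₂ κ * s₂ κ' ≤ s₂ (κ ⊔ κ') * s₂ (κ ⊓ κ')))
    (hsingle : ∀ (κ : E → ℝ), (∀ e, 0 < κ e) → ∀ (f : E) (cfm cfp : ℝ),
        0 < cfm → cfm < cfp →
        s₁ (Function.update κ f cfp) * s₂ (Function.update κ f cfm)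
          ≤ s₂ (Function.update κ f cfp) * s₁ (Function.update κ f cfm))
    {x y : E → ℝ} (hx : ∀ e, 0 < x e) (hy : ∀ e, 0 < y e) :
    s₁ x * s₂ y ≤ s₂ (x ⊔ y) * s₁ (x ⊓ y) := by
  have hsup : ∀ e, 0 < (x ⊔ y) e := fun e => (hx e).trans_le le_sup_left
  have hinf : ∀ e, 0 < (x ⊓ y) e := fun e => lt_inf_iff.mpr ⟨hx e, hy e⟩
  rcases hlattice with h | h
  · have hr := mul_le_mul_of_single_edge hs₁pos hs₂pos hsingle hy (le_sup_right : y ≤ x ⊔ y)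
    refine le_of_mul_le_mul_right ?_ (mul_pos (hs₁pos y hy) (hs₁pos _ hsup))
    have := mul_le_mul (h x y hx hy) hr (mul_pos (hs₁pos _ hsup) (hs₂pos y hy)).le
      (mul_pos (hs₁pos _ hsup) (hs₁pos _ hinf)).le
    linarith
  · have hr := mul_le_mul_of_single_edge hs₁pos hs₂pos hsingle hinf (inf_le_left : x ⊓ y ≤ x)
    refine le_of_mul_le_mul_right ?_ (mul_pos (hs₂pos x hx) (hs₂pos _ hinf))
    have := mul_le_mul (h x y hx hy) hr (mul_pos (hs₁pos x hx) (hs₂pos _ hinf)).le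
      (mul_pos (hs₂pos _ hsup) (hs₂pos _ hinf)).le
    linarith

/-- **Stochastic domination from a single-edge condition and one lattice density.**
If `μ₁ = s₁·ρ`, `μ₂ = s₂·ρ` are probability measures on `S = (0,∞)^E` with strictly
positive densities, at least one of `s₁, s₂` satisfies the FKG lattice condition, and the
single-edge Holley inequalities hold, then `μ₁` is stochastically dominated by `μ₂`. -/
theorem stoch_dom_from_single_edge
    {E : Type*} [Fintype E] [DecidableEq E]
    (ρ : E → Measure ℝ) [∀ e, IsFiniteMeasure (ρ e)]
    (hρsupp : ∀ e, ρ e (Set.Ioi (0 : ℝ))ᶜ = 0)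
    (s₁ s₂ : (E → ℝ) → ℝ)
    (hs₁meas : Measurable s₁) (hs₂meas : Measurable s₂)
    (hs₁pos : ∀ κ : E → ℝ, (∀ e, 0 < κ e) → 0 < s₁ κ)
    (hs₂pos : ∀ κ : E → ℝ, (∀ e, 0 < κ e) → 0 < s₂ κ)
    (μ₁ μ₂ : Measure (E → ℝ))
    (hμ₁ : μ₁ = (Measure.pi ρ).withDensity fun κ => ENNReal.ofReal (s₁ κ))
    (hμ₂ : μ₂ = (Measure.pi ρ).withDensity fun κ => ENNReal.ofReal (s₂ κ))
    [IsProbabilityMeasure μ₁] [IsProbabilityMeasure μ₂]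
    (hlattice :
      (∀ κ κ' : E → ℝ, (∀ e, 0 < κ e) → (∀ e, 0 < κ' e) →
          s₁ κ * s₁ κ' ≤ s₁ (κ ⊔ κ') * s₁ (κ ⊓ κ')) ∨
      (∀ κ κ' : E → ℝ, (∀ e, 0 < κ e) → (∀ e, 0 < κ' e) →
          s₂ κ * s₂ κ' ≤ s₂ (κ ⊔ κ') * s₂ (κ ⊓ κ')))
    (hsingle : ∀ (κ : E → ℝ), (∀ e, 0 < κ e) → ∀ (f : E) (cfm cfp : ℝ),
        0 < cfm → cfm < cfp →
        s₁ (Function.update κ f cfp) * s₂ (Function.update κ f cfm)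
          ≤ s₂ (Function.update κ f cfp) * s₁ (Function.update κ f cfm))
    (f : (E → ℝ) → ℝ) (hfmeas : Measurable f)
    (hfbdd : ∃ C : ℝ, ∀ κ, |f κ| ≤ C)
    (hfmono : ∀ κ κ' : E → ℝ, (∀ e, 0 < κ e) → (∀ e, 0 < κ' e) → κ ≤ κ' → f κ ≤ f κ') :
    ∫ κ, f κ ∂μ₁ ≤ ∫ κ, f κ ∂μ₂ := by
  classical
  obtain ⟨C, hC⟩ := hfbdd
  let S : Set (E → ℝ) := {κ | ∀ e, 0 < κ e}
  have hSmeas : MeasurableSet S := by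
    have : S = ⋂ e, {κ | 0 < κ e} := by ext; simp [S]
    rw [this]
    exact MeasurableSet.iInter fun e => measurableSet_lt measurable_const (measurable_pi_apply e)
  have hS : ∀ᵐ κ ∂Measure.pi ρ, κ ∈ S := by
    refine ae_all_iff.mpr fun e => ?_
    have he : ∀ᵐ t ∂ρ e, 0 < t := hρsupp e
    exact (Measure.tendsto_eval_ae_ae (μ := ρ) (i := e)).eventually he
  let F : (E → ℝ) → ENNReal := fun κ => ENNReal.ofReal (f κ + C)
  let w₁ : (E → ℝ) → ENNReal := S.indicator fun κ => ENNReal.ofReal (s₁ κ)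
  let w₂ : (E → ℝ) → ENNReal := S.indicator fun κ => ENNReal.ofReal (s₂ κ)
  have hF : Measurable F := (hfmeas.add_const C).ennreal_ofReal
  have hw₁ : Measurable w₁ := hs₁meas.ennreal_ofReal.indicator hSmeas
  have hw₂ : Measurable w₂ := hs₂meas.ennreal_ofReal.indicator hSmeas
  have hμ₁' : μ₁ = (Measure.pi ρ).withDensity w₁ := by
    rw [hμ₁]
    refine withDensity_congr_ae (hS.mono fun κ hκ => ?_)
    simp [w₁, hκ]
  have hμ₂' : μ₂ = (Measure.pi ρ).withDensity w₂ := by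
    rw [hμ₂]
    refine withDensity_congr_ae (hS.mono fun κ hκ => ?_)
    simp [w₂, hκ]
  have hmass {μ : Measure (E → ℝ)} [IsProbabilityMeasure μ] {w : (E → ℝ) → ENNReal}
      (hμ : μ = (Measure.pi ρ).withDensity w) : ∫⁻ κ, w κ ∂Measure.pi ρ = 1 := by
    rw [← setLIntegral_univ, ← withDensity_apply _ MeasurableSet.univ, ← hμ, measure_univ]
  have hholley (x y : E → ℝ) : (w₁ * F) x * w₂ y ≤ (w₂ * F) (x ⊔ y) * w₁ (x ⊓ y) := by
    by_cases hx : x ∈ S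
    swap
    · simp [w₁, hx]
    by_cases hy : y ∈ S
    swap
    · simp [w₂, hy]
    have hsup : x ⊔ y ∈ S := fun e => (hx e).trans_le le_sup_left
    have hinf : x ⊓ y ∈ S := fun e => lt_inf_iff.mpr ⟨hx e, hy e⟩
    have hH := holley_condition_of_single_edge hs₁pos hs₂pos hlattice hsingle hx hy
    have hFle : F x ≤ F (x ⊔ y) :=
      ENNReal.ofReal_le_ofReal (by linarith [hfmono x (x ⊔ y) hx hsup le_sup_left])
    have hwle : w₁ x * w₂ y ≤ w₂ (x ⊔ y) * w₁ (x ⊓ y) := by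
      simp only [w₁, w₂, Set.indicator_of_mem, hx, hy, hsup, hinf]
      rw [← ENNReal.ofReal_mul (hs₁pos x hx).le, ← ENNReal.ofReal_mul (hs₂pos _ hsup).le]
      exact ENNReal.ofReal_le_ofReal hH
    calc w₁ x * F x * w₂ y = w₁ x * w₂ y * F x := by ring
      _ ≤ w₂ (x ⊔ y) * w₁ (x ⊓ y) * F (x ⊔ y) := mul_le_mul' hwle hFle
      _ = w₂ (x ⊔ y) * F (x ⊔ y) * w₁ (x ⊓ y) := by ring
  have hfour := lintegral_pi_mul_lintegral_pi_le_of_sup_inf ρ (hw₁.mul hF) hw₂ (hw₂.mul hF) hw₁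
    hholley
  rw [hmass hμ₁', hmass hμ₂', mul_one, mul_one,
    ← lintegral_withDensity_eq_lintegral_mul _ hw₁ hF,
    ← lintegral_withDensity_eq_lintegral_mul _ hw₂ hF, ← hμ₁', ← hμ₂'] at hfour
  have hint (μ : Measure (E → ℝ)) [IsProbabilityMeasure μ] : Integrable f μ :=
    Integrable.of_bound hfmeas.aestronglyMeasurable C (Filter.Eventually.of_forall hC)
  have hnonneg (κ : E → ℝ) : 0 ≤ f κ + C := by linarith [neg_le_of_abs_le (hC κ)]
  have hadd (μ : Measure (E → ℝ)) [IsProbabilityMeasure μ] :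
      ∫ κ, (f κ + C) ∂μ = (∫ κ, f κ ∂μ) + C := by
    rw [integral_add (hint μ) (integrable_const C)]
    simp
  have hlint (μ : Measure (E → ℝ)) [IsProbabilityMeasure μ] :
      ∫⁻ κ, F κ ∂μ = ENNReal.ofReal ((∫ κ, f κ ∂μ) + C) := by
    rw [← hadd]
    exact (ofReal_integral_eq_lintegral_ofReal ((hint μ).add (integrable_const C))
      (Filter.Eventually.of_forall hnonneg)).symm
  have hμ₂nonneg : 0 ≤ (∫ κ, f κ ∂μ₂) + C := hadd μ₂ ▸ integral_nonneg fun κ => hnonneg κ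
  rw [hlint μ₁, hlint μ₂, ENNReal.ofReal_le_ofReal_iff hμ₂nonneg] at hfour
  linarith
end

section
/- FKG inequality for the random conductance model: Let G = (V, E) be a finite connected graph, fix v₀ ∈ V, and let D(κ) = det L(κ)[V∖{v₀}]. For each e ∈ E let ρ_e be a nonzero finite Borel measure on (0,∞) with support contained in [λ^{−1}, λ] for some λ ≥ 1, and let ρ = ⊗_{e∈E} ρ_e. Let μ be the probability measure on (0,∞)^E with density proportional to D(κ)^{−1/2} with respect to ρ. Then for all increasing measurable functions X, Y : (0,∞)^E → ℝ such that X, Y, and XY are μ-integrable, μ(XY) ≥ μ(X)·μ(Y). -/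
open MeasureTheory
open scoped Classical

/-- The weighted graph Laplacian of a finite graph `G` with conductances
`κ : Sym2 α → ℝ`. -/
noncomputable def glap {α : Type*} [Fintype α] (G : SimpleGraph α) (κ : Sym2 α → ℝ) :
    Matrix α α ℝ :=
  Matrix.of fun x y =>
    if x = y then ∑ z : α, (if G.Adj x z then κ s(x, z) else 0)
    else if G.Adj x y then -κ s(x, y) else 0

/-- The reduced determinant `det L(κ)[α∖W]`. -/
noncomputable def gdet {α : Type*} [Fintype α] (G : SimpleGraph α) (κ : Sym2 α → ℝ)
    (W : Set α) : ℝ :=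
  ((glap G κ).submatrix (fun x : {x : α // x ∉ W} => (x : α))
    (fun x : {x : α // x ∉ W} => (x : α))).det

/-- Extension of an edge-indexed conductance configuration to all of `Sym2 α`
(by `1` off the edge set, which is irrelevant for the Laplacian). -/
noncomputable def extendE {α : Type*} (G : SimpleGraph α) (c : G.edgeSet → ℝ) :
    Sym2 α → ℝ :=
  fun e => if h : e ∈ G.edgeSet then c ⟨e, h⟩ else 1

/-! ### A continuous four functions theorem -/

theorem ENNReal.add_le_add_of_mul_le_mul {a b c d : ENNReal} (hac : a ≤ c) (hbc : b ≤ c)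
    (h : a * b ≤ c * d) : a + b ≤ c + d := by
  rcases eq_or_ne c ⊤ with rfl | hc
  · simp
  rcases eq_or_ne d ⊤ with rfl | hd
  · simp
  lift c to NNReal using hc
  lift d to NNReal using hd
  lift a to NNReal using ne_top_of_le_ne_top coe_ne_top hac
  lift b to NNReal using ne_top_of_le_ne_top coe_ne_top hbc
  norm_cast at *
  rw [← NNReal.coe_le_coe] at *
  push_cast at *
  rcases (NNReal.coe_nonneg c).eq_or_lt with hc | hc
  · linarith [NNReal.coe_nonneg d, NNReal.coe_nonneg a, NNReal.coe_nonneg b]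
  · refine le_of_mul_le_mul_left ?_ hc
    nlinarith [mul_nonneg (sub_nonneg.2 hac) (sub_nonneg.2 hbc)]

/-- The integral four functions theorem on a linear order. -/
theorem lintegral_mul_lintegral_le_of_four_functions {α : Type*} [LinearOrder α]
    [MeasurableSpace α] (ν : Measure α) {f₁ f₂ f₃ f₄ : α → ENNReal}
    (h₁ : Measurable f₁) (h₂ : Measurable f₂) (h₃ : Measurable f₃) (h₄ : Measurable f₄)
    (h : ∀ s t, f₁ s * f₂ t ≤ f₃ (s ⊔ t) * f₄ (s ⊓ t)) :
    (∫⁻ s, f₁ s ∂ν) * ∫⁻ s, f₂ s ∂ν ≤ (∫⁻ s, f₃ s ∂ν) * ∫⁻ s, f₄ s ∂ν := by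
  have double : ∀ {g k : α → ENNReal}, Measurable g → Measurable k →
      ∫⁻ s, ∫⁻ t, (g s * k t + k s * g t) ∂ν ∂ν = 2 * ((∫⁻ s, g s ∂ν) * ∫⁻ s, k s ∂ν) := by
    intro g k hg hk
    have hs : ∀ s, ∫⁻ t, (g s * k t + k s * g t) ∂ν
        = g s * (∫⁻ t, k t ∂ν) + k s * ∫⁻ t, g t ∂ν := fun s => by
      rw [lintegral_add_left (hk.const_mul _), lintegral_const_mul _ hk, lintegral_const_mul _ hg]
    simp_rw [hs]
    rw [lintegral_add_left (hg.mul_const _), lintegral_mul_const _ hg, lintegral_mul_const _ hk,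
      mul_comm (∫⁻ s, k s ∂ν), two_mul]
  have pair : ∀ s t, s ≤ t → f₁ s * f₂ t + f₂ s * f₁ t ≤ f₃ s * f₄ t + f₄ s * f₃ t := by
    intro s t hst
    have hst' := h s t
    have hts := h t s
    have hss := h s s
    have htt := h t t
    simp only [sup_eq_right.2 hst, inf_eq_left.2 hst, sup_eq_left.2 hst, inf_eq_right.2 hst,
      sup_idem, inf_idem] at hst' hts hss htt
    rw [add_comm (f₃ s * f₄ t), mul_comm (f₄ s), mul_comm (f₂ s)]
    refine ENNReal.add_le_add_of_mul_le_mul hst' hts ?_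
    calc f₁ s * f₂ t * (f₁ t * f₂ s) = f₁ s * f₂ s * (f₁ t * f₂ t) := by ring
      _ ≤ f₃ s * f₄ s * (f₃ t * f₄ t) := mul_le_mul' hss htt
      _ = f₃ t * f₄ s * (f₃ s * f₄ t) := by ring
  refine (ENNReal.mul_le_mul_iff_right two_ne_zero ENNReal.ofNat_ne_top).1 ?_
  rw [← double h₁ h₂, ← double h₃ h₄]
  refine lintegral_mono fun s => lintegral_mono fun t => ?_
  rcases le_total s t with hst | hst
  · exact pair s t hst
  · have := pair t s hst
    calc f₁ s * f₂ t + f₂ s * f₁ t = f₁ t * f₂ s + f₂ t * f₁ s := by ring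
      _ ≤ f₃ t * f₄ s + f₄ t * f₃ s := this
      _ = _ := by ring

/-- The integral four functions theorem for finite product measures. -/
theorem lintegral_pi_mul_lintegral_pi_le_of_four_functions {ι : Type*} [Fintype ι]
    {α : ι → Type*} [∀ i, LinearOrder (α i)] [∀ i, MeasurableSpace (α i)]
    (ν : ∀ i, Measure (α i)) [∀ i, SigmaFinite (ν i)] {f₁ f₂ f₃ f₄ : (∀ i, α i) → ENNReal}
    (h₁ : Measurable f₁) (h₂ : Measurable f₂) (h₃ : Measurable f₃) (h₄ : Measurable f₄)
    (h : ∀ x y, f₁ x * f₂ y ≤ f₃ (x ⊔ y) * f₄ (x ⊓ y)) :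
    (∫⁻ x, f₁ x ∂Measure.pi ν) * ∫⁻ x, f₂ x ∂Measure.pi ν
      ≤ (∫⁻ x, f₃ x ∂Measure.pi ν) * ∫⁻ x, f₄ x ∂Measure.pi ν := by
  have marginals : ∀ (s : Finset ι) (x y : ∀ i, α i),
      lmarginal ν s f₁ x * lmarginal ν s f₂ y
        ≤ lmarginal ν s f₃ (x ⊔ y) * lmarginal ν s f₄ (x ⊓ y) := by
    intro s
    induction s using Finset.induction_on with
    | empty => simpa using h
    | insert i s hi ih =>
      intro x y
      rw [lmarginal_insert _ h₁ hi, lmarginal_insert _ h₂ hi, lmarginal_insert _ h₃ hi,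
        lmarginal_insert _ h₄ hi]
      refine lintegral_mul_lintegral_le_of_four_functions (ν i)
        ((h₁.lmarginal ν).comp (measurable_update _))
        ((h₂.lmarginal ν).comp (measurable_update _))
        ((h₃.lmarginal ν).comp (measurable_update _))
        ((h₄.lmarginal ν).comp (measurable_update _)) fun a b => ?_
      convert ih (Function.update x i a) (Function.update y i b) using 3
      · ext j
        by_cases hj : j = i
        · subst hj; simp
        · simp [hj]
      · ext j
        by_cases hj : j = i
        · subst hj; simp
        · simp [hj]
  rcases isEmpty_or_nonempty (∀ i, α i) with hE | ⟨⟨x⟩⟩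
  · simp [lintegral_of_isEmpty]
  · simpa [lmarginal_univ] using marginals Finset.univ x x

/-! ### Log-submodularity of the determinant -/

namespace Matrix

variable {n m : Type*} [Fintype n] [DecidableEq n] [Fintype m] [DecidableEq m]

theorem PosSemidef.one_le_det_one_add {P : Matrix n n ℝ} (hP : P.PosSemidef) :
    1 ≤ (1 + P).det := by
  have hU := hP.isHermitian.spectral_theorem
  set U := hP.isHermitian.eigenvectorUnitary
  have hUU : (U : Matrix n n ℝ) * star (U : Matrix n n ℝ) = 1 := Unitary.coe_mul_star_self U
  have hUU' : star (U : Matrix n n ℝ) * (U : Matrix n n ℝ) = 1 := Unitary.coe_star_mul_self U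
  rw [Unitary.conjStarAlgAut_apply] at hU
  have : 1 + P = (U : Matrix n n ℝ) *
      ((1 + diagonal hP.isHermitian.eigenvalues) * star (U : Matrix n n ℝ)) := by
    rw [add_mul, mul_add, one_mul, hUU, ← mul_assoc]
    exact congrArg (1 + ·) hU
  rw [this, det_mul_comm, mul_assoc, hUU', mul_one, ← diagonal_one, diagonal_add, det_diagonal]
  simpa using Finset.prod_le_prod (s := Finset.univ) (f := fun _ => (1 : ℝ))
    (g := fun i => 1 + hP.isHermitian.eigenvalues i) (fun _ _ => zero_le_one)
    fun i _ => le_add_of_nonneg_right (hP.eigenvalues_nonneg i)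

theorem PosSemidef.exists_eq_conjTranspose_mul_self {B : Matrix n n ℝ} (hB : B.PosSemidef) :
    ∃ R : Matrix n n ℝ, B = Rᴴ * R := by
  open scoped MatrixOrder Matrix.Norms.L2Operator in
  exact CStarAlgebra.nonneg_iff_eq_star_mul_self.1 (nonneg_iff_posSemidef.2 hB)

theorem det_add_conjTranspose_mul_self {A : Matrix n n ℝ} (hA : A.PosDef) (R : Matrix m n ℝ) :
    (A + Rᴴ * R).det = A.det * (1 + R * A⁻¹ * Rᴴ).det := by
  have hA' : IsUnit A.det := (isUnit_iff_isUnit_det A).1 hA.isUnit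
  rw [Matrix.mul_assoc R, det_one_add_mul_comm R, ← det_mul, mul_add, mul_one,
    Matrix.mul_assoc A⁻¹, ← Matrix.mul_assoc A, mul_nonsing_inv _ hA', one_mul]

theorem PosDef.det_le_det_add {A B : Matrix n n ℝ} (hA : A.PosDef) (hB : B.PosSemidef) :
    A.det ≤ (A + B).det := by
  obtain ⟨R, rfl⟩ := hB.exists_eq_conjTranspose_mul_self
  rw [det_add_conjTranspose_mul_self hA]
  exact le_mul_of_one_le_right hA.det_pos.le
    (hA.posSemidef.inv.mul_mul_conjTranspose_same R).one_le_det_one_add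

theorem PosDef.posSemidef_inv_sub_inv_add {A C : Matrix n n ℝ} (hA : A.PosDef)
    (hC : C.PosSemidef) : (A⁻¹ - (A + C)⁻¹).PosSemidef := by
  have hN := hA.add_posSemidef hC
  have hA' : IsUnit A.det := (isUnit_iff_isUnit_det A).1 hA.isUnit
  have hN' : IsUnit (A + C).det := (isUnit_iff_isUnit_det _).1 hN.isUnit
  have hCA : (C + Cᴴ * A⁻¹ * C).PosSemidef :=
    hC.add (hA.posSemidef.inv.conjTranspose_mul_mul_same C)
  have key : A⁻¹ - (A + C)⁻¹ = ((A + C)⁻¹)ᴴ * (C + Cᴴ * A⁻¹ * C) * (A + C)⁻¹ := by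
    have e : C + Cᴴ * A⁻¹ * C = (A + C) * A⁻¹ * (A + C) - (A + C) := by
      rw [hC.isHermitian.eq, add_mul, mul_nonsing_inv _ hA', add_mul, one_mul, mul_add,
        mul_assoc C A⁻¹ A, nonsing_inv_mul _ hA', mul_one]
      abel
    rw [e, hN.isHermitian.inv.eq, mul_sub, sub_mul, nonsing_inv_mul _ hN', one_mul, ← mul_assoc,
      ← mul_assoc, nonsing_inv_mul _ hN', one_mul, mul_assoc, mul_nonsing_inv _ hN', mul_one]
  rw [key]
  exact hCA.conjTranspose_mul_mul_same _

/-- The determinant is log-submodular on positive definite matrices. -/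
theorem PosDef.det_mul_det_add_add_le {A B C : Matrix n n ℝ} (hA : A.PosDef)
    (hB : B.PosSemidef) (hC : C.PosSemidef) :
    A.det * (A + C + B).det ≤ (A + B).det * (A + C).det := by
  have hN := hA.add_posSemidef hC
  obtain ⟨R, rfl⟩ := hB.exists_eq_conjTranspose_mul_self
  rw [det_add_conjTranspose_mul_self hA, det_add_conjTranspose_mul_self hN]
  have hP : (1 + R * (A + C)⁻¹ * Rᴴ).PosDef :=
    PosDef.one.add_posSemidef (hN.posSemidef.inv.mul_mul_conjTranspose_same R)
  have hle := hP.det_le_det_add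
    ((hA.posSemidef_inv_sub_inv_add hC).mul_mul_conjTranspose_same R)
  rw [mul_sub, sub_mul, add_assoc, add_sub_cancel] at hle
  nlinarith [mul_le_mul_of_nonneg_left hle (mul_pos hA.det_pos hN.det_pos).le]

end Matrix

/-! ### The reduced weighted Laplacian -/

section Laplacian

theorem extendE_of_mem {V : Type*} {G : SimpleGraph V} {c : G.edgeSet → ℝ}
    {e : Sym2 V} (he : e ∈ G.edgeSet) :
    extendE G c e = c ⟨e, he⟩ := dif_pos he

variable {V : Type*} [Fintype V] (G : SimpleGraph V)

theorem glap_mulVec (κ : Sym2 V → ℝ) (y : V → ℝ) (x : V) :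
    (glap G κ).mulVec y x = ∑ z, if G.Adj x z then κ s(x, z) * (y x - y z) else 0 := by
  have hsplit : ∀ z, glap G κ x z * y z
      = (if x = z then (∑ w, if G.Adj x w then κ s(x, w) else 0) * y x else 0)
        - if G.Adj x z then κ s(x, z) * y z else 0 := by
    intro z
    by_cases hxz : x = z
    · subst hxz; simp [glap]
    · by_cases ha : G.Adj x z <;> simp [glap, hxz, ha]
  simp only [Matrix.mulVec, dotProduct, hsplit, Finset.sum_sub_distrib, Finset.sum_ite_eq,
    Finset.mem_univ, if_true, Finset.sum_mul, ite_mul, zero_mul]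
  rw [← Finset.sum_sub_distrib]
  refine Finset.sum_congr rfl fun z _ => ?_
  split_ifs <;> ring

theorem dotProduct_glap_mulVec (κ : Sym2 V → ℝ) (y : V → ℝ) :
    y ⬝ᵥ (glap G κ).mulVec y
      = (∑ x, ∑ z, if G.Adj x z then κ s(x, z) * (y x - y z) ^ 2 else 0) / 2 := by
  have h₁ : y ⬝ᵥ (glap G κ).mulVec y
      = ∑ x, ∑ z, if G.Adj x z then κ s(x, z) * (y x * (y x - y z)) else 0 := by
    simp only [dotProduct, glap_mulVec, Finset.mul_sum]
    refine Finset.sum_congr rfl fun x _ => Finset.sum_congr rfl fun z _ => ?_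
    split_ifs <;> ring
  have h₂ := h₁
  rw [Finset.sum_comm] at h₂
  rw [eq_div_iff two_ne_zero, mul_two]
  nth_rewrite 1 [h₁]
  rw [h₂]
  simp only [← Finset.sum_add_distrib]
  refine Finset.sum_congr rfl fun x _ => Finset.sum_congr rfl fun z _ => ?_
  rw [G.adj_comm z x, Sym2.eq_swap]
  split_ifs <;> ring

theorem glap_isHermitian (κ : Sym2 V → ℝ) : (glap G κ).IsHermitian := by
  ext x z
  by_cases h : x = z
  · subst h; simp
  · simp [glap, h, Ne.symm h, G.adj_comm z x, Sym2.eq_swap (a := z)]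

theorem glap_posSemidef {κ : Sym2 V → ℝ} (hκ : ∀ e ∈ G.edgeSet, 0 ≤ κ e) :
    (glap G κ).PosSemidef := by
  refine .of_dotProduct_mulVec_nonneg (glap_isHermitian G κ) fun y => ?_
  rw [star_trivial, dotProduct_glap_mulVec]
  refine div_nonneg (Finset.sum_nonneg fun x _ => Finset.sum_nonneg fun z _ => ?_) two_pos.le
  split_ifs with h
  · exact mul_nonneg (hκ _ h) (sq_nonneg _)
  · exact le_rfl

/-- The weighted Laplacian with the rows and columns of `W` removed. -/
noncomputable def reducedLap (κ : Sym2 V → ℝ) (W : Set V) :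
    Matrix {x : V // x ∉ W} {x : V // x ∉ W} ℝ :=
  (glap G κ).submatrix (fun x : {x : V // x ∉ W} => (x : V))
    (fun x : {x : V // x ∉ W} => (x : V))

theorem reducedLap_add (κ κ' : Sym2 V → ℝ) (W : Set V) :
    reducedLap G (κ + κ') W = reducedLap G κ W + reducedLap G κ' W := by
  ext x z
  simp only [reducedLap, glap, Matrix.submatrix_apply, Matrix.of_apply, Matrix.add_apply,
    Pi.add_apply]
  split_ifs
  · rw [← Finset.sum_add_distrib]
    refine Finset.sum_congr rfl fun z _ => ?_
    split_ifs <;> simp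
  · ring
  · simp

theorem reducedLap_congr {κ κ' : Sym2 V → ℝ} (h : ∀ e ∈ G.edgeSet, κ e = κ' e) (W : Set V) :
    reducedLap G κ W = reducedLap G κ' W := by
  ext x z
  simp only [reducedLap, glap, Matrix.submatrix_apply, Matrix.of_apply]
  split_ifs with _ hxz
  · refine Finset.sum_congr rfl fun z _ => ?_
    split_ifs with hz
    exacts [h _ hz, rfl]
  · rw [h _ hxz]
  · rfl

variable {G}

theorem reducedLap_posDef (hconn : G.Connected) (v₀ : V) {κ : Sym2 V → ℝ}
    (hκ : ∀ e ∈ G.edgeSet, 0 < κ e) : (reducedLap G κ {v₀}).PosDef := by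
  refine .of_dotProduct_mulVec_pos ((glap_isHermitian G κ).submatrix _) fun y hy => ?_
  set u : V → ℝ := fun v => if h : v ∉ ({v₀} : Set V) then y ⟨v, h⟩ else 0 with hu
  have hu₀ : u v₀ = 0 := by simp [hu]
  have huy : ∀ v : {x : V // x ∉ ({v₀} : Set V)}, u v = y v := fun v => dif_pos v.2
  have sum_eq : ∀ g : V → ℝ, g v₀ = 0 →
      ∑ v : {x : V // x ∉ ({v₀} : Set V)}, g v = ∑ v, g v := fun g hg =>
    Fintype.sum_of_injective _ Subtype.val_injective _ _ (fun v hv => by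
      have : v = v₀ := by simpa using hv
      rw [this, hg]) fun _ => rfl
  have hquad : star y ⬝ᵥ (reducedLap G κ {v₀}).mulVec y = u ⬝ᵥ (glap G κ).mulVec u := by
    simp only [dotProduct, star_trivial, Matrix.mulVec, reducedLap, Matrix.submatrix_apply, ← huy]
    rw [← sum_eq (fun v => u v * ∑ z, glap G κ v z * u z) (by simp [hu₀])]
    refine Finset.sum_congr rfl fun v _ => ?_
    rw [← sum_eq (fun z => glap G κ v z * u z) (by simp [hu₀])]
  have hnn : 0 ≤ u ⬝ᵥ (glap G κ).mulVec u := by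
    simpa using (glap_posSemidef G fun e he => (hκ e he).le).dotProduct_mulVec_nonneg u
  rw [hquad]
  refine hnn.lt_of_ne fun h0 => hy ?_
  have hterm : ∀ x z, 0 ≤ if G.Adj x z then κ s(x, z) * (u x - u z) ^ 2 else 0 := by
    intro x z
    split_ifs with h
    exacts [mul_nonneg (hκ _ h).le (sq_nonneg _), le_rfl]
  have hadj : ∀ x z, G.Adj x z → u x = u z := by
    intro x z hxz
    rw [dotProduct_glap_mulVec, eq_comm, div_eq_zero_iff, or_iff_left two_ne_zero,
      Finset.sum_eq_zero_iff_of_nonneg fun x _ => Finset.sum_nonneg fun z _ => hterm x z] at h0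
    have h1 := (Finset.sum_eq_zero_iff_of_nonneg fun z _ => hterm x z).1
      (h0 x (Finset.mem_univ _)) z (Finset.mem_univ _)
    rw [if_pos hxz, mul_eq_zero, or_iff_right (hκ _ hxz).ne', sq_eq_zero_iff, sub_eq_zero] at h1
    exact h1
  have hwalk : ∀ x z, G.Walk x z → u x = u z := by
    intro x z p
    induction p with
    | nil => rfl
    | cons h _ ih => rw [hadj _ _ h, ih]
  have hconst : ∀ x, u x = 0 := fun x =>
    let ⟨p⟩ := hconn.preconnected x v₀
    (hwalk x v₀ p).trans hu₀
  ext v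
  rw [← huy, hconst, Pi.zero_apply]

theorem gdet_extendE_pos (hconn : G.Connected) (v₀ : V) {c : G.edgeSet → ℝ}
    (hc : ∀ e, 0 < c e) : 0 < gdet G (extendE G c) {v₀} :=
  (reducedLap_posDef hconn v₀ fun e he => by
    rw [extendE_of_mem he]
    exact hc _).det_pos

theorem reducedLap_extendE_eq_add (a b : G.edgeSet → ℝ) (W : Set V) :
    reducedLap G (extendE G b) W
      = reducedLap G (extendE G a) W + reducedLap G (extendE G (b - a)) W := by
  rw [← reducedLap_add]
  refine reducedLap_congr G (fun e he => ?_) W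
  simp [extendE_of_mem he]

theorem reducedLap_extendE_posSemidef {c : G.edgeSet → ℝ} (hc : 0 ≤ c) (W : Set V) :
    (reducedLap G (extendE G c) W).PosSemidef :=
  (glap_posSemidef G fun e he => by
    rw [extendE_of_mem he]
    exact hc _).submatrix _

theorem gdet_sup_mul_gdet_inf_le (hconn : G.Connected) (v₀ : V) {c c' : G.edgeSet → ℝ}
    (hc : ∀ e, 0 < c e) (hc' : ∀ e, 0 < c' e) :
    gdet G (extendE G (c ⊔ c')) {v₀} * gdet G (extendE G (c ⊓ c')) {v₀}
      ≤ gdet G (extendE G c) {v₀} * gdet G (extendE G c') {v₀} := by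
  have hA : (reducedLap G (extendE G (c ⊓ c')) {v₀}).PosDef :=
    reducedLap_posDef hconn v₀ fun e he => by
      rw [extendE_of_mem he]
      exact lt_min (hc _) (hc' _)
  have h := hA.det_mul_det_add_add_le
    (reducedLap_extendE_posSemidef (c := c - c ⊓ c') (sub_nonneg.2 inf_le_left) {v₀})
    (reducedLap_extendE_posSemidef (c := c' - c ⊓ c') (sub_nonneg.2 inf_le_right) {v₀})
  have hsup : c - c ⊓ c' = c ⊔ c' - c' := by
    rw [sub_eq_sub_iff_add_eq_add, ← inf_add_sup c c', add_comm]
  rw [← reducedLap_extendE_eq_add, ← reducedLap_extendE_eq_add, hsup,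
    ← reducedLap_extendE_eq_add] at h
  rw [mul_comm]
  exact h

theorem measurable_gdet_extendE (W : Set V) :
    Measurable fun c : G.edgeSet → ℝ => gdet G (extendE G c) W := by
  have hext : ∀ e, Continuous fun c : G.edgeSet → ℝ => extendE G c e := by
    intro e
    unfold extendE
    split_ifs <;> fun_prop
  refine (Continuous.matrix_det (continuous_matrix fun x z => ?_)).measurable
  simp only [glap, Matrix.submatrix_apply, Matrix.of_apply]
  split_ifs
  · refine continuous_finsetSum _ fun w _ => ?_
    split_ifs
    exacts [hext _, continuous_const]
  · exact (hext _).neg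
  · exact continuous_const

end Laplacian

/-! ### The FKG inequality -/

/-- The FKG inequality for a weight `w` that is log-supermodular on a sublattice `S` carrying the
product measure, for nonnegative functions. -/
theorem lintegral_fkg {ι : Type*} [Fintype ι] (ρ : ι → Measure ℝ) [∀ i, SigmaFinite (ρ i)]
    {S : Set (ι → ℝ)} (hS : MeasurableSet S) (hSsup : SupClosed S) (hSinf : InfClosed S)
    (hρS : ∀ᵐ c ∂Measure.pi ρ, c ∈ S) {w X Y : (ι → ℝ) → ENNReal}
    (hw : Measurable w) (hX : Measurable X) (hY : Measurable Y)
    (hwS : ∀ c ∈ S, ∀ c' ∈ S, w c * w c' ≤ w (c ⊔ c') * w (c ⊓ c'))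
    (hXS : MonotoneOn X S) (hYS : MonotoneOn Y S) :
    (∫⁻ c, X c ∂(Measure.pi ρ).withDensity w) * ∫⁻ c, Y c ∂(Measure.pi ρ).withDensity w
      ≤ (∫⁻ c, X c * Y c ∂(Measure.pi ρ).withDensity w)
        * (Measure.pi ρ).withDensity w Set.univ := by
  have lintegral_eq : ∀ {f : (ι → ℝ) → ENNReal}, Measurable f →
      ∫⁻ c, f c ∂(Measure.pi ρ).withDensity w
        = ∫⁻ c, S.indicator (fun c => w c * f c) c ∂Measure.pi ρ := by
    intro f hf
    rw [lintegral_withDensity_eq_lintegral_mul _ hw hf]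
    refine lintegral_congr_ae (hρS.mono fun c hc => ?_)
    rw [Set.indicator_of_mem hc, Pi.mul_apply]
  rw [← lintegral_one, lintegral_eq hX, lintegral_eq hY, lintegral_eq (f := fun c => X c * Y c) (hX.mul hY),
    lintegral_eq measurable_const]
  refine lintegral_pi_mul_lintegral_pi_le_of_four_functions ρ ((hw.mul hX).indicator hS)
    ((hw.mul hY).indicator hS) ((hw.mul (hX.mul hY)).indicator hS)
    ((hw.mul measurable_const).indicator hS) fun c c' => ?_
  by_cases hc : c ∈ S
  swap
  · simp [hc]
  by_cases hc' : c' ∈ S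
  swap
  · simp [hc']
  have hsup := hSsup hc hc'
  rw [Set.indicator_of_mem hc, Set.indicator_of_mem hc', Set.indicator_of_mem hsup,
    Set.indicator_of_mem (hSinf hc hc')]
  calc w c * X c * (w c' * Y c') = w c * w c' * (X c * Y c') := by ring
    _ ≤ w (c ⊔ c') * w (c ⊓ c') * (X (c ⊔ c') * Y (c ⊔ c')) :=
      mul_le_mul' (hwS c hc c' hc')
        (mul_le_mul' (hXS hc hsup le_sup_left) (hYS hc' hsup le_sup_right))
    _ = _ := by ring

/-- The FKG inequality for a log-supermodular probability density on a sublattice with a least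
element. -/
theorem integral_fkg {ι : Type*} [Fintype ι] (ρ : ι → Measure ℝ) [∀ i, SigmaFinite (ρ i)]
    {S : Set (ι → ℝ)} (hS : MeasurableSet S) (hSsup : SupClosed S) (hSinf : InfClosed S)
    {a : ι → ℝ} (ha : IsLeast S a)
    (hρS : ∀ᵐ c ∂Measure.pi ρ, c ∈ S) {w : (ι → ℝ) → ENNReal} {X Y : (ι → ℝ) → ℝ}
    [IsProbabilityMeasure ((Measure.pi ρ).withDensity w)]
    (hw : Measurable w) (hX : Measurable X) (hY : Measurable Y)
    (hwS : ∀ c ∈ S, ∀ c' ∈ S, w c * w c' ≤ w (c ⊔ c') * w (c ⊓ c'))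
    (hXS : MonotoneOn X S) (hYS : MonotoneOn Y S)
    (hXi : Integrable X ((Measure.pi ρ).withDensity w))
    (hYi : Integrable Y ((Measure.pi ρ).withDensity w))
    (hXYi : Integrable (fun c => X c * Y c) ((Measure.pi ρ).withDensity w)) :
    (∫ c, X c ∂(Measure.pi ρ).withDensity w) * (∫ c, Y c ∂(Measure.pi ρ).withDensity w)
      ≤ ∫ c, X c * Y c ∂(Measure.pi ρ).withDensity w := by
  have key := lintegral_fkg ρ hS hSsup hSinf hρS hw (hX.sub_const (X a)).ennreal_ofReal
    (hY.sub_const (Y a)).ennreal_ofReal hwS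
    (fun c hc c' hc' h => ENNReal.ofReal_le_ofReal (sub_le_sub_right (hXS hc hc' h) _))
    (fun c hc c' hc' h => ENNReal.ofReal_le_ofReal (sub_le_sub_right (hYS hc hc' h) _))
  have hμS : ∀ᵐ c ∂(Measure.pi ρ).withDensity w, c ∈ S :=
    (withDensity_absolutelyContinuous _ _).ae_le hρS
  revert key
  generalize (Measure.pi ρ).withDensity w = μ at *
  intro key
  have hX0 : 0 ≤ᵐ[μ] fun c => X c - X a :=
    hμS.mono fun c hc => sub_nonneg.2 (hXS ha.1 hc (ha.2 hc))
  have hY0 : 0 ≤ᵐ[μ] fun c => Y c - Y a :=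
    hμS.mono fun c hc => sub_nonneg.2 (hYS ha.1 hc (ha.2 hc))
  have hX' : Integrable (fun c => X c - X a) μ := hXi.sub (integrable_const _)
  have hY' : Integrable (fun c => Y c - Y a) μ := hYi.sub (integrable_const _)
  have hexp : ∀ c, (X c - X a) * (Y c - Y a)
      = X c * Y c - Y a * X c - (X a * Y c - X a * Y a) := fun c => by ring
  have hi₁ : Integrable (fun c => X c * Y c - Y a * X c) μ := hXYi.sub (hXi.const_mul _)
  have hi₂ : Integrable (fun c => X a * Y c - X a * Y a) μ :=
    (hYi.const_mul _).sub (integrable_const _)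
  have hXY' : Integrable (fun c => (X c - X a) * (Y c - Y a)) μ := by
    simp_rw [hexp]
    exact hi₁.sub hi₂
  have hXY0 : 0 ≤ᵐ[μ] fun c => (X c - X a) * (Y c - Y a) := by
    filter_upwards [hX0, hY0] with c h h' using mul_nonneg h h'
  have hprod : ∫⁻ c, ENNReal.ofReal (X c - X a) * ENNReal.ofReal (Y c - Y a) ∂μ
      = ∫⁻ c, ENNReal.ofReal ((X c - X a) * (Y c - Y a)) ∂μ :=
    lintegral_congr_ae (hX0.mono fun c h => (ENNReal.ofReal_mul h).symm)
  rw [measure_univ, mul_one, hprod, ← ofReal_integral_eq_lintegral_ofReal hX' hX0,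
    ← ofReal_integral_eq_lintegral_ofReal hY' hY0,
    ← ofReal_integral_eq_lintegral_ofReal hXY' hXY0,
    ← ENNReal.ofReal_mul (integral_nonneg_of_ae hX0),
    ENNReal.ofReal_le_ofReal_iff (integral_nonneg_of_ae hXY0)] at key
  simp_rw [hexp] at key
  rw [integral_sub hi₁ hi₂, integral_sub hXYi (hXi.const_mul _),
    integral_sub (hYi.const_mul _) (integrable_const _), integral_sub hXi (integrable_const _),
    integral_sub hYi (integrable_const _), integral_const_mul, integral_const_mul] at key
  simp only [integral_const, probReal_univ, one_smul] at key
  linarith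

/-- **FKG inequality for the random conductance model**: the probability measure on
`(0,∞)^E` with density proportional to `D(κ)^{-1/2}` with respect to a product of finite
measures supported in `[λ⁻¹, λ]` satisfies `μ(XY) ≥ μ(X)·μ(Y)` for increasing measurable
`X, Y` with `X`, `Y`, `XY` integrable. -/
theorem fkg_random_conductance
    {V : Type*} [Fintype V] (G : SimpleGraph V) (hconn : G.Connected) (v₀ : V)
    (lam : ℝ) (hlam : 1 ≤ lam)
    (ρ : G.edgeSet → Measure ℝ) [∀ e, IsFiniteMeasure (ρ e)]
    (hρne : ∀ e, ρ e ≠ 0)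
    (hρsupp : ∀ e, ρ e (Set.Icc lam⁻¹ lam)ᶜ = 0)
    (Z : ℝ) (hZ : 0 < Z)
    (μ : Measure (G.edgeSet → ℝ))
    (hμ : μ = (Measure.pi ρ).withDensity fun c =>
      ENNReal.ofReal (Z * (Real.sqrt (gdet G (extendE G c) {v₀}))⁻¹))
    [IsProbabilityMeasure μ]
    (X Y : (G.edgeSet → ℝ) → ℝ) (hXmeas : Measurable X) (hYmeas : Measurable Y)
    (hXmono : ∀ c c' : G.edgeSet → ℝ,
      (∀ e, 0 < c e) → (∀ e, 0 < c' e) → c ≤ c' → X c ≤ X c')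
    (hYmono : ∀ c c' : G.edgeSet → ℝ,
      (∀ e, 0 < c e) → (∀ e, 0 < c' e) → c ≤ c' → Y c ≤ Y c')
    (hXint : Integrable X μ) (hYint : Integrable Y μ)
    (hXYint : Integrable (fun c => X c * Y c) μ) :
    (∫ c, X c ∂μ) * (∫ c, Y c ∂μ) ≤ ∫ c, X c * Y c ∂μ := by
  have hlam0 : 0 < lam⁻¹ := inv_pos.2 (zero_lt_one.trans_le hlam)
  set S : Set (G.edgeSet → ℝ) := Set.Icc (fun _ => lam⁻¹) (fun _ => lam)
  have hpos : ∀ c ∈ S, ∀ e, 0 < c e := fun c hc e => hlam0.trans_le (hc.1 e)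
  have hρS : ∀ᵐ c ∂Measure.pi ρ, c ∈ S := by
    have : ∀ᵐ c ∂Measure.pi ρ, ∀ e, c e ∈ Set.Icc lam⁻¹ lam :=
      ae_all_iff.2 fun e => Measure.tendsto_eval_ae_ae.eventually (hρsupp e)
    exact this.mono fun c hc => ⟨fun e => (hc e).1, fun e => (hc e).2⟩
  have hle : lam⁻¹ ≤ lam := (inv_le_one_of_one_le₀ hlam).trans hlam
  subst hμ
  refine integral_fkg ρ measurableSet_Icc (fun c hc c' hc' => ⟨le_sup_of_le_left hc.1,
    sup_le hc.2 hc'.2⟩) (fun c hc c' hc' => ⟨le_inf hc.1 hc'.1, inf_le_of_left_le hc.2⟩)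
    (isLeast_Icc fun _ => hle) hρS
    ((measurable_gdet_extendE {v₀}).sqrt.inv.const_mul Z).ennreal_ofReal hXmeas hYmeas ?_
    (fun c hc c' hc' h => hXmono c c' (hpos c hc) (hpos c' hc') h)
    (fun c hc c' hc' h => hYmono c c' (hpos c hc) (hpos c' hc') h) hXint hYint hXYint
  intro c hc c' hc'
  have hsup : ∀ e, 0 < (c ⊔ c') e := fun e => lt_sup_of_lt_left (hpos c hc e)
  have hinf : ∀ e, 0 < (c ⊓ c') e := fun e => lt_min (hpos c hc e) (hpos c' hc' e)
  have hd := gdet_extendE_pos hconn v₀ hsup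
  have hd' := gdet_extendE_pos hconn v₀ hinf
  have hD := gdet_sup_mul_gdet_inf_le hconn v₀ (hpos c hc) (hpos c' hc')
  rw [← ENNReal.ofReal_mul (by positivity), ← ENNReal.ofReal_mul (by positivity),
    mul_mul_mul_comm, mul_mul_mul_comm Z (√(gdet G (extendE G (c ⊔ c')) {v₀}))⁻¹, ← mul_inv,
    ← mul_inv,
    ← Real.sqrt_mul (gdet_extendE_pos hconn v₀ (hpos c hc)).le, ← Real.sqrt_mul hd.le]
  gcongr
end
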